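/- Let α ∈ [0,1], β = √(1−α²), c > 0, and let m_{c,α} be the expander profile. Then the function m(x,t) := m_{c,α}(x/√t), defined for (x,t) ∈ ℝ × (0,∞), is a C^∞ solution of the Landau–Lifshitz–Gilbert equation ∂ₜm = β m × ∂ₓₓm − α m × (m × ∂ₓₓm) on ℝ × (0,∞), and it satisfies |∂ₓm(x,t)| = (c/√t) e^{−αx²/(4t)} for all (x,t) ∈ ℝ × (0,∞). -/

import Mathlib

noncomputable section

open Real MeasureTheory Filter Topology

/-- `E3` is `ℝ³` with the Euclidean norm. -/
abbrev E3 : Type := EuclideanSpace ℝ (Fin 3)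

def toE3 (v : Fin 3 → ℝ) : E3 := (WithLp.equiv 2 (Fin 3 → ℝ)).symm v

/-- The cross product in `ℝ³`. -/
def cross (a b : E3) : E3 :=
  toE3 ![a 1 * b 2 - a 2 * b 1, a 2 * b 0 - a 0 * b 2, a 0 * b 1 - a 1 * b 0]

def e1 : E3 := EuclideanSpace.single 0 1
def e2 : E3 := EuclideanSpace.single 1 1
def e3 : E3 := EuclideanSpace.single 2 1

/-- `(m, n, b)` solves the Serret–Frenet system with curvature `k(x) = c e^{-αx²/4}`,
torsion `τ(x) = βx/2` and initial conditions `(e₁, e₂, e₃)`. -/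
def IsSF (α β c : ℝ) (m n b : ℝ → E3) : Prop :=
  (∀ x : ℝ, HasDerivAt m ((c * Real.exp (-α * x ^ 2 / 4)) • n x) x) ∧
  (∀ x : ℝ, HasDerivAt n
    ((-(c * Real.exp (-α * x ^ 2 / 4))) • m x + (β * x / 2) • b x) x) ∧
  (∀ x : ℝ, HasDerivAt b ((-(β * x / 2)) • n x) x) ∧
  m 0 = e1 ∧ n 0 = e2 ∧ b 0 = e3

/-- The three components of a differentiable `E3`-valued curve are differentiable. -/
theorem HasDerivAt.apply_E3 {f : ℝ → E3} {f' : E3} {x : ℝ} (h : HasDerivAt f f' x) (i : Fin 3) :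
    HasDerivAt (fun y => f y i) (f' i) x := by
  exact (EuclideanSpace.proj i : E3 →L[ℝ] ℝ).hasFDerivAt.comp_hasDerivAt x h

/-- A curve in `E3` is differentiable if its three components are. -/
theorem HasDerivAt.of_apply_E3 {f : ℝ → E3} {f' : E3} {x : ℝ}
    (h : ∀ i, HasDerivAt (fun y => f y i) (f' i) x) : HasDerivAt f f' x :=
  (EuclideanSpace.equiv (Fin 3) ℝ).symm.toContinuousLinearMap.hasFDerivAt.comp_hasDerivAt x
    (hasDerivAt_pi.2 h)

@[simp] theorem toE3_apply (v : Fin 3 → ℝ) (i : Fin 3) : toE3 v i = v i := rfl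

theorem cross_smul (r : ℝ) (a b : E3) : cross a (r • b) = r • cross a b := by
  ext i; fin_cases i <;> simp [cross] <;> ring

theorem cross_add (a b d : E3) : cross a (b + d) = cross a b + cross a d := by
  ext i; fin_cases i <;> simp [cross] <;> ring

theorem cross_zero (a : E3) : cross a 0 = 0 := by
  ext i; fin_cases i <;> simp [cross]

theorem cross_self_E3 (a : E3) : cross a a = 0 := by
  ext i; fin_cases i <;> simp [cross] <;> ring

theorem HasDerivAt.cross {f g : ℝ → E3} {f' g' : E3} {x : ℝ} (hf : HasDerivAt f f' x)
    (hg : HasDerivAt g g' x) :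
    HasDerivAt (fun y => cross (f y) (g y)) (cross f' (g x) + cross (f x) g') x := by
  have aux (i j k l : Fin 3) := ((hf.apply_E3 i).mul (hg.apply_E3 j)).sub
    ((hf.apply_E3 k).mul (hg.apply_E3 l))
  refine .of_apply_E3 fun i => ?_
  fin_cases i
  · refine (aux 1 2 2 1).congr_deriv ?_
    simp [_root_.cross]
    ring
  · refine (aux 2 0 0 2).congr_deriv ?_
    simp [_root_.cross]
    ring
  · refine (aux 0 1 1 0).congr_deriv ?_
    simp [_root_.cross]
    ring

theorem norm_sq_E3 (a : E3) : ‖a‖ ^ 2 = a 0 ^ 2 + a 1 ^ 2 + a 2 ^ 2 := by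
  simp [EuclideanSpace.norm_sq_eq, Fin.sum_univ_three]

theorem contDiff_of_hasDerivAt_add {E : Type*} [NormedAddCommGroup E] [NormedSpace ℝ E]
    {f f' : ℝ → E} {k : ℕ} (h : ∀ x, HasDerivAt f (f' x) x) (hf' : ContDiff ℝ k f') :
    ContDiff ℝ ((k + 1 : ℕ) : WithTop ℕ∞) f := by
  push_cast
  rw [contDiff_succ_iff_deriv]
  refine ⟨fun x => (h x).differentiableAt, by simp, ?_⟩
  rwa [funext fun x => (h x).deriv]

theorem deriv_comp_div {E : Type*} [NormedAddCommGroup E] [NormedSpace ℝ E]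
    {f f' : ℝ → E} (h : ∀ x, HasDerivAt f (f' x) x) (r : ℝ) :
    deriv (fun y => f (y / r)) = fun y => r⁻¹ • f' (y / r) := by
  funext x
  have h1 : HasDerivAt (fun y : ℝ => y / r) r⁻¹ x := by
    simpa using (hasDerivAt_id x).div_const r
  exact ((h (x / r)).scomp x h1).deriv

namespace IsSF

variable {α β c : ℝ} {m n b : ℝ → E3}

theorem contDiff_nat (h : IsSF α β c m n b) (k : ℕ) :
    ContDiff ℝ k m ∧ ContDiff ℝ k n ∧ ContDiff ℝ k b := by
  obtain ⟨hm, hn, hb, -⟩ := h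
  induction k with
  | zero =>
    simp only [Nat.cast_zero, contDiff_zero]
    exact ⟨continuous_iff_continuousAt.2 fun x => (hm x).continuousAt,
      continuous_iff_continuousAt.2 fun x => (hn x).continuousAt,
      continuous_iff_continuousAt.2 fun x => (hb x).continuousAt⟩
  | succ k ih =>
    obtain ⟨im, iN, ib⟩ := ih
    exact ⟨contDiff_of_hasDerivAt_add hm (by fun_prop), contDiff_of_hasDerivAt_add hn (by fun_prop),
      contDiff_of_hasDerivAt_add hb (by fun_prop)⟩

theorem contDiff (h : IsSF α β c m n b) : ContDiff ℝ (⊤ : ℕ∞) m :=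
  contDiff_infty.2 fun k => (h.contDiff_nat k).1

/-- The sum of the squared norms of the frame is conserved. -/
theorem sum_norm_sq (h : IsSF α β c m n b) (x : ℝ) :
    ‖m x‖ ^ 2 + ‖n x‖ ^ 2 + ‖b x‖ ^ 2 = 3 := by
  obtain ⟨hm, hn, hb, m0, n0, b0⟩ := h
  have hE (y : ℝ) : HasDerivAt (fun y => ‖m y‖ ^ 2 + ‖n y‖ ^ 2 + ‖b y‖ ^ 2) 0 y := by
    refine (((hm y).norm_sq.add (hn y).norm_sq).add (hb y).norm_sq).congr_deriv ?_
    simp only [inner_smul_right, inner_add_right, real_inner_comm (m y) (n y),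
      real_inner_comm (b y) (n y)]
    ring
  have := is_const_of_deriv_eq_zero (fun y => (hE y).differentiableAt) (fun y => (hE y).deriv) x 0
  rw [this, m0, n0, b0]
  norm_num [e1, e2, e3]

/-- The frame stays positively oriented: `m × n = b`, `n × b = m`, `b × m = n`. -/
theorem cross_eq (h : IsSF α β c m n b) (x : ℝ) :
    cross (m x) (n x) = b x ∧ cross (n x) (b x) = m x ∧ cross (b x) (m x) = n x := by
  obtain ⟨hm, hn, hb, m0, n0, b0⟩ := h
  have hE (y : ℝ) : HasDerivAt (fun y => ‖cross (m y) (n y) - b y‖ ^ 2 +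
      ‖cross (n y) (b y) - m y‖ ^ 2 + ‖cross (b y) (m y) - n y‖ ^ 2) 0 y := by
    refine (((((HasDerivAt.cross (hm y) (hn y)).sub (hb y)).norm_sq).add
      ((HasDerivAt.cross (hn y) (hb y)).sub (hm y)).norm_sq).add
      ((HasDerivAt.cross (hb y) (hm y)).sub (hn y)).norm_sq).congr_deriv ?_
    simp only [Pi.sub_apply, PiLp.inner_apply, Fin.sum_univ_three, cross, toE3_apply, PiLp.sub_apply,
      PiLp.add_apply, PiLp.smul_apply, smul_eq_mul, RCLike.inner_apply, conj_trivial,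
      Matrix.cons_val]
    ring
  have h0 := is_const_of_deriv_eq_zero (fun y => (hE y).differentiableAt)
    (fun y => (hE y).deriv) x 0
  have hz : ‖cross (m 0) (n 0) - b 0‖ ^ 2 + ‖cross (n 0) (b 0) - m 0‖ ^ 2 +
      ‖cross (b 0) (m 0) - n 0‖ ^ 2 = 0 := by
    rw [m0, n0, b0]
    simp only [norm_sq_E3]
    simp [cross, e1, e2, e3]
  simp only [hz] at h0
  have key {u : ℝ} {v : E3} (hv : ‖v‖ ^ 2 = u) (hu : u ≤ 0) : v = 0 := by
    rw [← norm_eq_zero]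
    exact pow_eq_zero_iff two_ne_zero |>.1 (le_antisymm (hv ▸ hu) (sq_nonneg _))
  have p1 := sq_nonneg ‖cross (m x) (n x) - b x‖
  have p2 := sq_nonneg ‖cross (n x) (b x) - m x‖
  have p3 := sq_nonneg ‖cross (b x) (m x) - n x‖
  exact ⟨sub_eq_zero.1 (key rfl (by linarith)), sub_eq_zero.1 (key rfl (by linarith)),
    sub_eq_zero.1 (key rfl (by linarith))⟩

theorem norm_n (h : IsSF α β c m n b) (x : ℝ) : ‖n x‖ = 1 := by
  obtain ⟨h1, h2, h3⟩ := h.cross_eq x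
  have hs := h.sum_norm_sq x
  have hmn : ‖m x‖ ^ 2 = ‖n x‖ ^ 2 := by
    nth_rewrite 1 [norm_sq_E3, norm_sq_E3]
    have e0 := congrArg (fun v : E3 => v 0) h2
    have e1 := congrArg (fun v : E3 => v 1) h2
    have e2 := congrArg (fun v : E3 => v 2) h2
    have f0 := congrArg (fun v : E3 => v 0) h3
    have f1 := congrArg (fun v : E3 => v 1) h3
    have f2 := congrArg (fun v : E3 => v 2) h3
    simp [cross] at e0 e1 e2 f0 f1 f2
    linear_combination (-m x 0) * e0 - m x 1 * e1 - m x 2 * e2 + n x 0 * f0 + n x 1 * f1 + n x 2 * f2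
  have hbn : ‖b x‖ ^ 2 = ‖n x‖ ^ 2 := by
    nth_rewrite 1 [norm_sq_E3, norm_sq_E3]
    have e0 := congrArg (fun v : E3 => v 0) h1
    have e1 := congrArg (fun v : E3 => v 1) h1
    have e2 := congrArg (fun v : E3 => v 2) h1
    have f0 := congrArg (fun v : E3 => v 0) h3
    have f1 := congrArg (fun v : E3 => v 1) h3
    have f2 := congrArg (fun v : E3 => v 2) h3
    simp [cross] at e0 e1 e2 f0 f1 f2
    linear_combination (-b x 0) * e0 - b x 1 * e1 - b x 2 * e2 + n x 0 * f0 + n x 1 * f1 + n x 2 * f2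
  have : ‖n x‖ ^ 2 = 1 := by linarith
  exact (pow_eq_one_iff_of_nonneg (norm_nonneg _) two_ne_zero).1 this

theorem cross_m_b (h : IsSF α β c m n b) (x : ℝ) : cross (m x) (b x) = -n x := by
  rw [← (h.cross_eq x).2.2]
  ext i; fin_cases i <;> simp [cross] <;> ring

theorem hasDerivAt_curvature_smul_n (h : IsSF α β c m n b) (x : ℝ) :
    HasDerivAt (fun x => (c * Real.exp (-α * x ^ 2 / 4)) • n x)
      ((c * Real.exp (-α * x ^ 2 / 4)) • ((-(c * Real.exp (-α * x ^ 2 / 4))) • m x +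
        (β * x / 2) • b x + (-(α * x / 2)) • n x)) x := by
  have hk : HasDerivAt (fun x : ℝ => c * Real.exp (-α * x ^ 2 / 4))
      (c * (Real.exp (-α * x ^ 2 / 4) * (-α * (2 * x) / 4))) x := by
    refine ((((hasDerivAt_pow 2 x).const_mul (-α)).div_const 4).exp.const_mul c).congr_deriv ?_
    simp
  refine (hk.smul (h.2.1 x)).congr_deriv ?_
  module

/-- The profile equation of an expander, solved for the first derivative. -/
theorem profile_eq (h : IsSF α β c m n b) (hαβ : α ^ 2 + β ^ 2 = 1) (x : ℝ) :
    β • cross (m x) ((-(c * Real.exp (-α * x ^ 2 / 4))) • m x +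
        (β * x / 2) • b x + (-(α * x / 2)) • n x) -
      α • cross (m x) (cross (m x) ((-(c * Real.exp (-α * x ^ 2 / 4))) • m x +
        (β * x / 2) • b x + (-(α * x / 2)) • n x)) = (-(x / 2)) • n x := by
  simp only [cross_add, cross_smul, cross_self_E3, cross_zero, h.cross_m_b, (h.cross_eq x).1, ← neg_one_smul ℝ (n x)]
  match_scalars
  · linear_combination (-x / 2) * hαβ
  · ring

end IsSF

/-- the self-similar map `m(x,t) = m_{c,α}(x/√t)` is a smooth solution of the
Landau–Lifshitz–Gilbert equation on `ℝ × (0,∞)` with `|∂ₓm(x,t)| = (c/√t)e^{-αx²/(4t)}`. -/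
theorem expander_is_LLG_solution
    (α β c : ℝ) (hα : α ∈ Set.Icc (0 : ℝ) 1) (hβ : β = Real.sqrt (1 - α ^ 2)) (hc : 0 < c)
    (m n b : ℝ → E3) (hSF : IsSF α β c m n b) :
    ContDiffOn ℝ (⊤ : ℕ∞)
      (fun p : ℝ × ℝ => m (p.1 / Real.sqrt p.2)) (Set.univ ×ˢ Set.Ioi 0) ∧
    (∀ x : ℝ, ∀ t ∈ Set.Ioi (0 : ℝ),
      deriv (fun s => m (x / Real.sqrt s)) t =
        β • cross (m (x / Real.sqrt t)) (deriv (deriv (fun y => m (y / Real.sqrt t))) x)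
          - α • cross (m (x / Real.sqrt t))
              (cross (m (x / Real.sqrt t))
                (deriv (deriv (fun y => m (y / Real.sqrt t))) x))) ∧
    (∀ x : ℝ, ∀ t ∈ Set.Ioi (0 : ℝ),
      ‖deriv (fun y => m (y / Real.sqrt t)) x‖ =
        (c / Real.sqrt t) * Real.exp (-α * x ^ 2 / (4 * t))) := by
  have hαβ : α ^ 2 + β ^ 2 = 1 := by
    rw [hβ, Real.sq_sqrt] <;> nlinarith [hα.1, hα.2]
  have hd (t : ℝ) := deriv_comp_div hSF.1 (Real.sqrt t)
  refine ⟨?_, fun x t ht => ?_, fun x t ht => ?_⟩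
  · refine hSF.contDiff.comp_contDiffOn (contDiffOn_fst.div ?_ fun p hp => ?_)
    · exact contDiffOn_snd.sqrt fun p hp => (Set.mem_Ioi.1 hp.2).ne'
    · exact (Real.sqrt_pos.2 hp.2).ne'
  · have hr : 0 < Real.sqrt t := Real.sqrt_pos.2 ht
    have hx : HasDerivAt (fun s => x / Real.sqrt s)
        (-(x / Real.sqrt t / 2) * (Real.sqrt t)⁻¹ ^ 2) t := by
      refine ((Real.hasDerivAt_sqrt ht.ne').fun_inv hr.ne' |>.const_mul x).congr_deriv ?_
      field_simp
    have hdt : deriv (fun s => m (x / Real.sqrt s)) t = _ := ((hSF.1 _).scomp t hx).deriv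
    rw [hdt, hd, deriv_fun_const_smul_field, deriv_comp_div hSF.hasDerivAt_curvature_smul_n]
    have hp := hSF.profile_eq hαβ (x / Real.sqrt t)
    simp only [cross_smul]
    linear_combination (norm := module) (-((Real.sqrt t)⁻¹ ^ 2 *
      (c * Real.exp (-α * (x / Real.sqrt t) ^ 2 / 4)))) • hp
  · have hr : 0 < Real.sqrt t := Real.sqrt_pos.2 ht
    rw [hd, norm_smul, norm_smul, hSF.norm_n, Real.norm_of_nonneg (by positivity),
      Real.norm_of_nonneg (by positivity), div_pow, Real.sq_sqrt (le_of_lt ht)]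
    field_simp
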